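/- arXiv:2509.18803 — 8 statements merged into one kernel-verified Lean document; each statement's English description precedes it below -/
import Mathlib

section
/- The four-qubit GHZ state ρ_GHZ₄ is not a virtual quantum Markov chain: there exists no Hermitian-preserving, trace-preserving linear map R : M₂(ℂ) → M₄(ℂ) (acting on factor C, with output identified with C⊗D) such that (id_AB ⊗ R)(Tr_D ρ_GHZ₄) = ρ_GHZ₄. In particular, no completely positive trace-preserving map R achieves this either. -/
open Matrix
open scoped ComplexOrder

noncomputable section

abbrev Q : Type := Fin 2
abbrev M2 : Type := Matrix Q Q ℂ
abbrev M4 : Type := Matrix (Q × Q) (Q × Q) ℂ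
abbrev Q3 : Type := Q × Q × Q
abbrev Q4 : Type := Q × Q × Q × Q

/-- Matrix units `E i j = |i⟩⟨j|` on `ℂ²`. -/
def MU (i j : Q) : M2 := fun k l => if k = i ∧ l = j then 1 else 0

/-- A linear map `R : M₂(ℂ) → M₄(ℂ)` is trace-preserving. -/
def TP (R : M2 →ₗ[ℂ] M4) : Prop := ∀ X : M2, (R X).trace = X.trace

/-- A linear map `R : M₂(ℂ) → M₄(ℂ)` is Hermitian-preserving. -/
def HP (R : M2 →ₗ[ℂ] M4) : Prop := ∀ X : M2, R Xᴴ = (R X)ᴴ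

/-- Choi matrix `Σ_{ij} E_{ij} ⊗ R(E_{ij})` of `R : M₂(ℂ) → M₄(ℂ)`. -/
def Choi (R : M2 →ₗ[ℂ] M4) : Matrix Q3 Q3 ℂ := fun x y => R (MU x.1 y.1) x.2 y.2

/-- Complete positivity: the Choi matrix is positive semidefinite. -/
def CP (R : M2 →ₗ[ℂ] M4) : Prop := (Choi R).PosSemidef

/-- Partial trace over the fourth factor `D`. -/
def trD (M : Matrix Q4 Q4 ℂ) : Matrix Q3 Q3 ℂ := fun x y =>
  ∑ d : Q, M (x.1, x.2.1, x.2.2, d) (y.1, y.2.1, y.2.2, d)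

/-- `(id_AB ⊗ R)` applied to a three-qubit matrix, `R` acting on factor `C`
with output identified with `C ⊗ D`. -/
def idAB (R : M2 →ₗ[ℂ] M4) (ρ : Matrix Q3 Q3 ℂ) : Matrix Q4 Q4 ℂ := fun x y =>
  ∑ c : Q, ∑ c' : Q,
    ρ (x.1, x.2.1, c) (y.1, y.2.1, c') * R (MU c c') x.2.2 y.2.2

/-- The four-qubit GHZ state vector. -/
def ghz4 : Q4 → ℂ := fun x =>
  if x = (0,0,0,0) ∨ x = (1,1,1,1) then (Real.sqrt 2 : ℂ)⁻¹ else 0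

/-- `ρ_GHZ₄ = |GHZ₄⟩⟨GHZ₄|`. -/
def rhoGHZ4 : Matrix Q4 Q4 ℂ := vecMulVec ghz4 (star ghz4)

/-- No linear map at all recovers the GHZ state: the `(0000),(1111)` entry is lost. -/
theorem no_recovery (R : M2 →ₗ[ℂ] M4) : idAB R (trD rhoGHZ4) ≠ rhoGHZ4 := by
  intro h
  have h1 := congrFun (congrFun h (0,0,0,0)) (1,1,1,1)
  simp [idAB, trD, rhoGHZ4, vecMulVec_apply, ghz4, Fin.sum_univ_two] at h1

/-- The four-qubit GHZ state is not a virtual quantum Markov chain: no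
Hermitian-preserving trace-preserving map recovers it from its `ABC` marginal;
in particular no completely positive trace-preserving map does either. -/
theorem stmt3 :
    (¬ ∃ R : M2 →ₗ[ℂ] M4, HP R ∧ TP R ∧ idAB R (trD rhoGHZ4) = rhoGHZ4) ∧
    (¬ ∃ R : M2 →ₗ[ℂ] M4, CP R ∧ TP R ∧ idAB R (trD rhoGHZ4) = rhoGHZ4) := by
  exact ⟨fun ⟨R, _, _, h⟩ => no_recovery R h, fun ⟨R, _, _, h⟩ => no_recovery R h⟩
end
end

section
/- For every p with 0 < p < 1, the mixed state ρ_p := p ρ_W₄ + (1−p) ρ_GHZ₄ is not a virtual quantum Markov chain: there exists no Hermitian-preserving, trace-preserving linear map R : M₂(ℂ) → M₄(ℂ) (acting on factor C, with output identified with C⊗D) such that (id_AB ⊗ R)(Tr_D ρ_p) = ρ_p. -/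
open Matrix
open scoped ComplexOrder

noncomputable section

/-- The four-qubit W state vector. -/
def w4 : Q4 → ℂ := fun x =>
  if x = (0,0,0,1) ∨ x = (0,0,1,0) ∨ x = (0,1,0,0) ∨ x = (1,0,0,0) then 1/2 else 0

/-- `ρ_W₄ = |W₄⟩⟨W₄|`. -/
def rhoW4 : Matrix Q4 Q4 ℂ := vecMulVec w4 (star w4)

/-- The mixture `ρ_p = p ρ_W₄ + (1-p) ρ_GHZ₄`. -/
def rhoP (p : ℝ) : Matrix Q4 Q4 ℂ := (p : ℂ) • rhoW4 + ((1 - p : ℝ) : ℂ) • rhoGHZ4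

/-- For every `0 < p < 1`, the mixture `ρ_p = p ρ_W₄ + (1-p) ρ_GHZ₄` is not a
virtual quantum Markov chain. -/
theorem stmt4 (p : ℝ) (hp0 : 0 < p) (hp1 : p < 1) :
    ¬ ∃ R : M2 →ₗ[ℂ] M4, HP R ∧ TP R ∧ idAB R (trD (rhoP p)) = rhoP p := by
  rintro ⟨R, -, -, h⟩
  have h1 := congrFun (congrFun h (0,0,0,0)) (1,1,1,1)
  have hne : (1 - (p : ℂ)) ≠ 0 := by
    intro h0
    have : (p : ℂ) = 1 := (sub_eq_zero.mp h0).symm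
    have : p = 1 := by exact_mod_cast this
    linarith
  simp [idAB, trD, rhoP, rhoW4, rhoGHZ4, vecMulVec_apply, w4, ghz4, Fin.sum_univ_two] at h1
  exact hne h1
end
end

section
/- For every p with 1/4 ≤ p ≤ 1, the three-qubit marginal ρ_ABC^(p) := Tr_D(p ρ_W₄ + (1−p) ρ_GHZ₄) satisfies the kernel-inclusion condition: for each j ∈ {0,1}, Ker(ρ̂_{AC|j}) ⊆ Ker(ρ̂_{BC|j}). -/
open Matrix
open scoped ComplexOrder

noncomputable section

/-- Conditional operator `ρ̂_{AC|j}` of a three-qubit state. -/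
def rAC (ρ : Matrix Q3 Q3 ℂ) (j : Q) : M4 := fun x y =>
  if x.2 = j ∧ y.2 = j then ∑ b : Q, ρ (x.1, b, j) (y.1, b, j) else 0

/-- Conditional operator `ρ̂_{BC|j}` of a three-qubit state. -/
def rBC (ρ : Matrix Q3 Q3 ℂ) (j : Q) : M4 := fun x y =>
  if x.2 = j ∧ y.2 = j then ∑ a : Q, ρ (a, x.1, j) (a, y.1, j) else 0

/-- `|W₄⟩` is invariant under swapping `A` and `B`. -/
lemma w4_swap (a b c d : Q) : w4 (a, b, c, d) = w4 (b, a, c, d) := by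
  have h : ((a, b, c, d) = ((0,0,0,1) : Q4) ∨ (a, b, c, d) = ((0,0,1,0) : Q4) ∨
      (a, b, c, d) = ((0,1,0,0) : Q4) ∨ (a, b, c, d) = ((1,0,0,0) : Q4)) ↔
      ((b, a, c, d) = ((0,0,0,1) : Q4) ∨ (b, a, c, d) = ((0,0,1,0) : Q4) ∨
      (b, a, c, d) = ((0,1,0,0) : Q4) ∨ (b, a, c, d) = ((1,0,0,0) : Q4)) := by
    revert a b c d; decide
  simp only [w4, h]

/-- `|GHZ₄⟩` is invariant under swapping `A` and `B`. -/
lemma ghz4_swap (a b c d : Q) : ghz4 (a, b, c, d) = ghz4 (b, a, c, d) := by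
  have h : ((a, b, c, d) = ((0,0,0,0) : Q4) ∨ (a, b, c, d) = ((1,1,1,1) : Q4)) ↔
      ((b, a, c, d) = ((0,0,0,0) : Q4) ∨ (b, a, c, d) = ((1,1,1,1) : Q4)) := by
    revert a b c d; decide
  simp only [ghz4, h]

lemma rhoP_swap (p : ℝ) (a b c d a' b' c' d' : Q) :
    rhoP p (a, b, c, d) (a', b', c', d') = rhoP p (b, a, c, d) (b', a', c', d') := by
  simp only [rhoP, rhoW4, rhoGHZ4, Matrix.add_apply, Matrix.smul_apply, vecMulVec_apply,
    Pi.star_apply]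
  rw [w4_swap a b, w4_swap a' b', ghz4_swap a b, ghz4_swap a' b']

/-- By the `A ↔ B` symmetry the two conditional operators coincide. -/
lemma rAC_eq_rBC (p : ℝ) (j : Q) : rAC (trD (rhoP p)) j = rBC (trD (rhoP p)) j := by
  funext x y
  simp only [rAC, rBC, trD]
  congr 1
  refine Finset.sum_congr rfl fun b _ => Finset.sum_congr rfl fun d _ => ?_
  exact rhoP_swap p _ _ _ _ _ _ _ _

/-- For `1/4 ≤ p ≤ 1` the three-qubit marginal of `ρ_p` satisfies the
kernel-inclusion condition for each `j ∈ {0,1}`. -/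
theorem stmt5 (p : ℝ) (hp0 : 1/4 ≤ p) (hp1 : p ≤ 1) (j : Q) :
    LinearMap.ker (rAC (trD (rhoP p)) j).mulVecLin ≤
      LinearMap.ker (rBC (trD (rhoP p)) j).mulVecLin := by
  rw [rAC_eq_rBC]
end
end

section
/- There exists a four-qubit state that satisfies the kernel-inclusion condition but is not a virtual quantum Markov chain. Concretely, for every p with 1/4 ≤ p < 1 the state ρ_p := p ρ_W₄ + (1−p) ρ_GHZ₄ satisfies Ker(ρ̂_{AC|j}) ⊆ Ker(ρ̂_{BC|j}) for j ∈ {0,1} (with conditional operators formed from ρ_ABC^(p) = Tr_D ρ_p), yet no Hermitian-preserving, trace-preserving linear map R : M₂(ℂ) → M₄(ℂ) satisfies (id_AB ⊗ R)(ρ_ABC^(p)) = ρ_p. -/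
open Matrix
open scoped ComplexOrder

noncomputable section

/-- For every `1/4 ≤ p < 1`, the state `ρ_p` satisfies the kernel-inclusion
condition yet is not a virtual quantum Markov chain. -/
theorem stmt6 (p : ℝ) (hp0 : 1/4 ≤ p) (hp1 : p < 1) :
    (∀ j : Q, LinearMap.ker (rAC (trD (rhoP p)) j).mulVecLin ≤
        LinearMap.ker (rBC (trD (rhoP p)) j).mulVecLin) ∧
    ¬ ∃ R : M2 →ₗ[ℂ] M4, HP R ∧ TP R ∧ idAB R (trD (rhoP p)) = rhoP p := by
  constructor
  · intro j
    have h : rAC (trD (rhoP p)) j = rBC (trD (rhoP p)) j := by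
      ext ⟨a, c⟩ ⟨a', c'⟩
      fin_cases j <;> fin_cases a <;> fin_cases c <;> fin_cases a' <;> fin_cases c' <;>
        simp [rAC, rBC, trD, rhoP, rhoW4, rhoGHZ4, vecMulVec_apply, w4, ghz4]
    rw [h]
  · rintro ⟨R, -, -, h⟩
    have h1 := congrFun (congrFun h (0, 0, 0, 0)) (1, 1, 1, 1)
    simp [idAB, trD, rhoP, rhoW4, rhoGHZ4, vecMulVec_apply, w4, ghz4] at h1
    have h2 : (1 : ℂ) - (p : ℂ) = 0 := by
      simpa using h1
    have h3 : (1 : ℝ) - p = 0 := by exact_mod_cast h2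
    linarith
end
end

section
/- The four-qubit W state ρ_W₄ is a virtual quantum Markov chain: there exists a Hermitian-preserving, trace-preserving linear map R : M₂(ℂ) → M₄(ℂ) (acting on factor C, with output identified with C⊗D) such that (id_AB ⊗ R)(Tr_D ρ_W₄) = ρ_W₄. -/
open Matrix
open scoped ComplexOrder

noncomputable section

/-- Indicator of `|00⟩`. -/
def eV : Q × Q → ℂ := fun p => if p = (0,0) then 1 else 0

/-- The vector `|01⟩ + |10⟩`. -/
def sV : Q × Q → ℂ := fun p => if p = (0,1) ∨ p = (1,0) then 1 else 0

/-- The recovery map. -/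
def recMap : M2 →ₗ[ℂ] M4 where
  toFun X := Matrix.of fun p q => X 0 0 * (eV p * eV q) + X 0 1 * (eV p * sV q)
    + X 1 0 * (sV p * eV q) + X 1 1 * (sV p * sV q - eV p * eV q)
  map_add' X Y := by
    ext p q
    simp only [Matrix.add_apply, Matrix.of_apply]
    ring
  map_smul' c X := by
    ext p q
    simp only [Matrix.smul_apply, Matrix.of_apply, smul_eq_mul, RingHom.id_apply]
    ring

lemma recMap_apply (X : M2) (p q : Q × Q) : recMap X p q =
    X 0 0 * (eV p * eV q) + X 0 1 * (eV p * sV q)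
    + X 1 0 * (sV p * eV q) + X 1 1 * (sV p * sV q - eV p * eV q) := rfl

lemma star_eV (p : Q × Q) : star (eV p) = eV p := by
  unfold eV; split_ifs <;> simp

lemma star_sV (p : Q × Q) : star (sV p) = sV p := by
  unfold sV; split_ifs <;> simp

lemma star_w4 (p : Q4) : star (w4 p) = w4 p := by
  unfold w4; split_ifs <;> simp

set_option maxHeartbeats 4000000 in
/-- The four-qubit W state is a virtual quantum Markov chain: some
Hermitian-preserving trace-preserving map recovers it from its `ABC` marginal. -/
theorem stmt9 : ∃ R : M2 →ₗ[ℂ] M4, HP R ∧ TP R ∧ idAB R (trD rhoW4) = rhoW4 := by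
  refine ⟨recMap, ?_, ?_, ?_⟩
  · intro X
    ext p q
    simp only [recMap_apply, Matrix.conjTranspose_apply, star_add, star_mul', star_sub,
      star_eV, star_sV]
    ring
  · intro X
    simp [Matrix.trace, recMap_apply, Fintype.sum_prod_type, eV, sV]
  · ext ⟨a, b, c, d⟩ ⟨a', b', c', d'⟩
    simp only [idAB, trD, rhoW4, vecMulVec_apply, Pi.star_apply, star_w4, recMap_apply,
      Fin.sum_univ_two]
    fin_cases a <;> fin_cases b <;> fin_cases a' <;> fin_cases b' <;>
    fin_cases c <;> fin_cases d <;> fin_cases c' <;> fin_cases d' <;>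
      norm_num [w4, MU, eV, sV]
end
end

section
/- For every λ with 0 < λ < 1, the convex combination ρ_λ := λ ρ_W₄ + (1−λ) ρ₂, where ρ₂ = ½(|0000⟩⟨0000| + |1111⟩⟨1111|), is not a virtual quantum Markov chain: there exists no Hermitian-preserving, trace-preserving linear map R : M₂(ℂ) → M₄(ℂ) (acting on factor C, with output identified with C⊗D) such that (id_AB ⊗ R)(Tr_D ρ_λ) = ρ_λ. -/
open Matrix
open scoped ComplexOrder

noncomputable section

/-- The classical state `ρ₂ = ½(|0000⟩⟨0000| + |1111⟩⟨1111|)`. -/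
def rho2 : Matrix Q4 Q4 ℂ := fun x y =>
  if x = ((0:Q),(0:Q),(0:Q),(0:Q)) ∧ y = ((0:Q),(0:Q),(0:Q),(0:Q)) then 1/2
  else if x = ((1:Q),(1:Q),(1:Q),(1:Q)) ∧ y = ((1:Q),(1:Q),(1:Q),(1:Q)) then 1/2 else 0

/-- The mixture `ρ_λ = λ ρ_W₄ + (1-λ) ρ₂`. -/
def rhoLam (l : ℝ) : Matrix Q4 Q4 ℂ := (l : ℂ) • rhoW4 + ((1 - l : ℝ) : ℂ) • rho2

/-- For every `0 < λ < 1`, the mixture `ρ_λ` is not a virtual quantum Markov chain. -/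
theorem stmt12 (l : ℝ) (h0 : 0 < l) (h1 : l < 1) :
    ¬ ∃ R : M2 →ₗ[ℂ] M4, HP R ∧ TP R ∧ idAB R (trD (rhoLam l)) = rhoLam l := by
  rintro ⟨R, -, -, h⟩
  have e1 := congrFun (congrFun h (0,1,1,1)) (0,1,1,1)
  have e2 := congrFun (congrFun h (1,1,1,1)) (1,1,1,1)
  have e3 := congrFun (congrFun h (0,0,1,1)) (0,0,1,1)
  have hl : (l : ℂ) ≠ 0 := by exact_mod_cast h0.ne'
  have hl1 : (1 - l : ℂ) ≠ 0 := by
    have : (1 - l : ℝ) ≠ 0 := by linarith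
    exact_mod_cast this
  simp [idAB, trD, rhoLam, rhoW4, rho2, w4, vecMulVec_apply, Fin.sum_univ_two, hl] at e1 e2 e3
  simp [e1, hl] at e3
  simp [e3, hl1] at e2
end
end

section
/- The set of four-qubit virtual quantum Markov chain states is not convex: there exist four-qubit density matrices ρ₁ and ρ₂, each admitting a Hermitian-preserving, trace-preserving linear map R : M₂(ℂ) → M₄(ℂ) with (id_AB ⊗ R)(Tr_D ρᵢ) = ρᵢ, and a λ ∈ (0,1), such that the state λρ₁ + (1−λ)ρ₂ admits no such map. -/
open Matrix
open scoped ComplexOrder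

noncomputable section

/-- Computational basis projector on four qubits. -/
def basisState (p : Q4) : Matrix Q4 Q4 ℂ := Matrix.diagonal (fun x => if x = p then 1 else 0)

/-- The replacement map `X ↦ Tr(X) |q⟩⟨q|`. -/
def replaceMap (q : Q × Q) : M2 →ₗ[ℂ] M4 :=
  (Matrix.traceLinearMap Q ℂ ℂ).smulRight (Matrix.diagonal (fun x => if x = q then 1 else 0))

lemma replaceMap_apply (q : Q × Q) (X : M2) :
    replaceMap q X = X.trace • Matrix.diagonal (fun x => if x = q then 1 else 0) := rfl

lemma basisState_psd (p : Q4) : (basisState p).PosSemidef := by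
  apply Matrix.PosSemidef.diagonal
  intro x
  show (0 : ℂ) ≤ if x = p then 1 else 0
  split_ifs <;> simp

lemma basisState_trace (p : Q4) : (basisState p).trace = 1 := by
  simp [basisState, Matrix.trace_diagonal]

lemma replaceMap_HP (q : Q × Q) : HP (replaceMap q) := by
  intro X
  rw [replaceMap_apply, replaceMap_apply, Matrix.trace_conjTranspose,
    Matrix.conjTranspose_smul, Matrix.diagonal_conjTranspose]
  congr 2
  funext x
  simp only [Pi.star_apply]
  split_ifs <;> simp

lemma replaceMap_TP (q : Q × Q) : TP (replaceMap q) := by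
  intro X
  simp [replaceMap_apply, Matrix.trace_smul, Matrix.trace_diagonal]

lemma trace_MU (c c' : Q) : (MU c c').trace = if c = c' then 1 else 0 := by
  fin_cases c <;> fin_cases c' <;> simp [MU, Matrix.trace]

lemma replace_basisState (a b c d : Q) :
    idAB (replaceMap (c, d)) (trD (basisState (a, b, c, d))) = basisState (a, b, c, d) := by
  ext ⟨x1, x2, x3, x4⟩ ⟨y1, y2, y3, y4⟩
  simp only [idAB, trD, basisState, replaceMap_apply, trace_MU, Matrix.smul_apply,
    Matrix.diagonal_apply, Prod.mk.injEq, smul_eq_mul, Fin.sum_univ_two]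
  fin_cases c <;> fin_cases d <;> simp <;> grind

/-- The set of four-qubit virtual quantum Markov chain states is not convex. -/
theorem stmt13 :
    ∃ (ρ₁ ρ₂ : Matrix Q4 Q4 ℂ),
      ρ₁.PosSemidef ∧ ρ₁.trace = 1 ∧ ρ₂.PosSemidef ∧ ρ₂.trace = 1 ∧
      (∃ R : M2 →ₗ[ℂ] M4, HP R ∧ TP R ∧ idAB R (trD ρ₁) = ρ₁) ∧
      (∃ R : M2 →ₗ[ℂ] M4, HP R ∧ TP R ∧ idAB R (trD ρ₂) = ρ₂) ∧
      ∃ l : ℝ, 0 < l ∧ l < 1 ∧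
        ¬ ∃ R : M2 →ₗ[ℂ] M4, HP R ∧ TP R ∧
          idAB R (trD ((l : ℂ) • ρ₁ + ((1 - l : ℝ) : ℂ) • ρ₂)) =
            (l : ℂ) • ρ₁ + ((1 - l : ℝ) : ℂ) • ρ₂ := by
  refine ⟨basisState (0, 0, 0, 0), basisState (1, 0, 0, 1), basisState_psd _, basisState_trace _,
    basisState_psd _, basisState_trace _,
    ⟨replaceMap (0, 0), replaceMap_HP _, replaceMap_TP _, replace_basisState _ _ _ _⟩,
    ⟨replaceMap (0, 1), replaceMap_HP _, replaceMap_TP _, replace_basisState _ _ _ _⟩,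
    1 / 2, by norm_num, by norm_num, ?_⟩
  rintro ⟨R, -, -, h⟩
  have h1 := congrFun (congrFun h (0, 0, 0, 1)) (0, 0, 0, 1)
  have h2 := congrFun (congrFun h (1, 0, 0, 1)) (1, 0, 0, 1)
  simp [idAB, trD, basisState, Matrix.diagonal_apply, Fin.sum_univ_two] at h1 h2
  norm_num [h1] at h2
end
end

section
/- Every Hermitian-preserving, trace-preserving linear map Φ : M_n(ℂ) → M_m(ℂ) can be written as a quasiprobability combination Φ = c₁N₁ − c₂N₂, where c₁, c₂ ≥ 0 and N₁, N₂ : M_n(ℂ) → M_m(ℂ) are completely positive trace-preserving maps. -/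
open Matrix
open scoped ComplexOrder

abbrev Mat (n : ℕ) : Type := Matrix (Fin n) (Fin n) ℂ

/-- Matrix units `E i j = |i⟩⟨j|`. -/
def MUn {n : ℕ} (i j : Fin n) : Mat n := fun k l => if k = i ∧ l = j then 1 else 0

/-- Trace-preserving linear map on matrix algebras. -/
def TPg {n m : ℕ} (Φ : Mat n →ₗ[ℂ] Mat m) : Prop := ∀ X : Mat n, (Φ X).trace = X.trace

/-- Hermitian-preserving linear map on matrix algebras. -/
def HPg {n m : ℕ} (Φ : Mat n →ₗ[ℂ] Mat m) : Prop := ∀ X : Mat n, Φ Xᴴ = (Φ X)ᴴ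

/-- Choi matrix `Σ_{ij} E_{ij} ⊗ Φ(E_{ij})` on `ℂⁿ ⊗ ℂᵐ`. -/
def Choig {n m : ℕ} (Φ : Mat n →ₗ[ℂ] Mat m) :
    Matrix (Fin n × Fin m) (Fin n × Fin m) ℂ := fun x y => Φ (MUn x.1 y.1) x.2 y.2

/-- Complete positivity: the Choi matrix is positive semidefinite. -/
def CPg {n m : ℕ} (Φ : Mat n →ₗ[ℂ] Mat m) : Prop := (Choig Φ).PosSemidef

section aux
open scoped MatrixOrder Matrix.Norms.L2Operator

lemma aux_shift {ι : Type} [Fintype ι] [DecidableEq ι] (A : Matrix ι ι ℂ) (hA : A.IsHermitian) :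
    ∃ c : ℝ, 0 ≤ c ∧ (A + (c : ℂ) • (1 : Matrix ι ι ℂ)).PosSemidef := by
  refine ⟨‖A‖, norm_nonneg _, ?_⟩
  have h : IsSelfAdjoint A := hA
  have h2 := h.neg_algebraMap_norm_le_self
  rw [Matrix.le_iff] at h2
  rw [sub_neg_eq_add, Algebra.algebraMap_eq_smul_one] at h2
  have e : (‖A‖ : ℝ) • (1 : Matrix ι ι ℂ) = ((‖A‖ : ℝ) : ℂ) • (1 : Matrix ι ι ℂ) := by
    ext i j
    simp [Matrix.smul_apply]
  rw [e] at h2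
  exact h2

end aux

/-- The completely depolarizing map. -/
noncomputable def depol (n m : ℕ) : Mat n →ₗ[ℂ] Mat m :=
  (Matrix.traceLinearMap (Fin n) ℂ ℂ).smulRight ((m : ℂ)⁻¹ • (1 : Mat m))

lemma MUn_trace {n : ℕ} (i j : Fin n) : (MUn i j).trace = if i = j then 1 else 0 := by
  simp only [Matrix.trace, Matrix.diag, MUn]
  by_cases h : i = j
  · subst h; simp
  · rw [if_neg h]
    apply Finset.sum_eq_zero
    intro k _
    rw [if_neg]
    rintro ⟨rfl, rfl⟩
    exact h rfl

lemma depol_choi (n m : ℕ) : Choig (depol n m) = (m : ℂ)⁻¹ • 1 := by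
  ext ⟨i, a⟩ ⟨j, b⟩
  simp only [Choig, depol, LinearMap.smulRight_apply, Matrix.traceLinearMap_apply, MUn_trace,
    Matrix.smul_apply, Matrix.one_apply, Prod.mk.injEq, smul_eq_mul]
  by_cases h : i = j <;> by_cases h' : a = b <;> simp [h, h']

lemma MUn_conj {n : ℕ} (i j : Fin n) : (MUn i j)ᴴ = MUn j i := by
  ext k l
  simp only [Matrix.conjTranspose_apply, MUn, and_comm]
  split_ifs <;> simp

lemma choi_herm {n m : ℕ} (Φ : Mat n →ₗ[ℂ] Mat m) (hHP : HPg Φ) : (Choig Φ).IsHermitian := by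
  ext ⟨i, a⟩ ⟨j, b⟩
  simp only [Matrix.conjTranspose_apply, Choig]
  rw [← MUn_conj j i, hHP, Matrix.conjTranspose_apply]

/-- Every Hermitian-preserving trace-preserving map is a quasiprobability
combination `Φ = c₁ N₁ - c₂ N₂` of CPTP maps with `c₁, c₂ ≥ 0`. -/
theorem stmt15 {n m : ℕ} (Φ : Mat n →ₗ[ℂ] Mat m) (hHP : HPg Φ) (hTP : TPg Φ) :
    ∃ (c₁ c₂ : ℝ) (N₁ N₂ : Mat n →ₗ[ℂ] Mat m),
      0 ≤ c₁ ∧ 0 ≤ c₂ ∧ CPg N₁ ∧ TPg N₁ ∧ CPg N₂ ∧ TPg N₂ ∧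
      Φ = (c₁ : ℂ) • N₁ - (c₂ : ℂ) • N₂ := by
  rcases Nat.eq_zero_or_pos m with rfl | hm
  · have hCP : CPg Φ := by
      have : Choig Φ = 0 := by
        ext ⟨i, a⟩ _
        exact a.elim0
      rw [CPg, this]
      exact Matrix.PosSemidef.zero
    exact ⟨1, 0, Φ, Φ, zero_le_one, le_rfl, hCP, hTP, hCP, hTP, by simp⟩
  · obtain ⟨c, hc, hpos⟩ := aux_shift _ (choi_herm Φ hHP)
    have hm0 : (m : ℂ) ≠ 0 := by exact_mod_cast hm.ne'
    have hD : TPg (depol n m) := by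
      intro X
      simp [depol, Matrix.trace_smul, hm0]
    have hd : 0 ≤ c * m := by positivity
    have hd1 : (1 + (c : ℂ) * m) ≠ 0 := by
      have : (1 + c * m : ℝ) ≠ 0 := by positivity
      exact_mod_cast this
    refine ⟨1 + c * m, c * m, (((1 + c * m)⁻¹ : ℝ) : ℂ) • (Φ + ((c * m : ℝ) : ℂ) • depol n m),
      depol n m, by positivity, hd, ?_, ?_, ?_, hD, ?_⟩
    · have : Choig ((((1 + c * m)⁻¹ : ℝ) : ℂ) • (Φ + ((c * m : ℝ) : ℂ) • depol n m))
          = (((1 + c * m)⁻¹ : ℝ) : ℂ) • (Choig Φ + (c : ℂ) • 1) := by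
        have h1 : (c : ℂ) • (1 : Matrix (Fin n × Fin m) (Fin n × Fin m) ℂ)
            = ((c * m : ℝ) : ℂ) • Choig (depol n m) := by
          rw [depol_choi, smul_smul]
          congr 1
          push_cast
          field_simp
        rw [h1]
        rfl
      rw [CPg, this]
      refine hpos.smul ?_
      have : (0 : ℝ) ≤ (1 + c * m)⁻¹ := by positivity
      exact_mod_cast this
    · intro X
      simp only [LinearMap.smul_apply, LinearMap.add_apply, Matrix.trace_smul, Matrix.trace_add,
        hTP X, hD X, smul_eq_mul]
      push_cast
      field_simp
    · rw [CPg, depol_choi]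
      refine Matrix.PosSemidef.one.smul ?_
      have h0 : (0 : ℝ) ≤ (m : ℝ)⁻¹ := by positivity
      have h1 : (0 : ℂ) ≤ (((m : ℝ)⁻¹ : ℝ) : ℂ) := Complex.zero_le_real.mpr h0
      simpa using h1
    · rw [smul_smul]
      have : ((1 + c * m : ℝ) : ℂ) * (((1 + c * m)⁻¹ : ℝ) : ℂ) = 1 := by
        push_cast
        exact mul_inv_cancel₀ hd1
      rw [this, one_smul, add_sub_cancel_right]
end
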